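/- arXiv:0802.1414 — 2 statements merged into one kernel-verified Lean document; each statement's English description precedes it below -/
import Mathlib

section
/- For every h>0, every r>0 and every z∈ℂ with Re z<0 one has |∫₀^∞ e^{zt}(p_h(r,t) − p_0(r,t)) dt| ≤ ∫₀^∞ e^{(Re z)t} p_0(r,t) dt − exp(−h·r²/4)·∫₀^∞ e^{(Re z−h)t} p_0(r,t) dt. In Green-function terms: |F_h(x,y;z) − G_0(x,y;z)| ≤ G_0(x,y;Re z) − G_0(x,y;Re z−h)·exp(−h|x−y|²/4). -/
open MeasureTheory Real Set

/-- Modulus of the Landau heat kernel at distance `r`. -/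
noncomputable def landauHeatKernel (h r t : ℝ) : ℝ :=
  h / (4 * π * Real.sinh (h * t)) *
    Real.exp (-(h * r ^ 2 * (Real.cosh (h * t) / Real.sinh (h * t))) / 4)

/-- Free heat kernel on `ℝ²` at distance `r`. -/
noncomputable def freeHeatKernel (r t : ℝ) : ℝ :=
  1 / (4 * π * t) * Real.exp (-(r ^ 2) / (4 * t))

theorem sinh_le_mul_cosh {s : ℝ} (hs : 0 < s) : Real.sinh s ≤ s * Real.cosh s := by
  obtain ⟨c, hc, hslope⟩ := exists_hasDerivAt_eq_slope Real.sinh Real.cosh hs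
    Real.continuous_sinh.continuousOn (fun x _ => Real.hasDerivAt_sinh x)
  rw [Real.sinh_zero, sub_zero, sub_zero, eq_div_iff hs.ne'] at hslope
  rw [← hslope, mul_comm]
  have hcosh : Real.cosh c ≤ Real.cosh s :=
    Real.cosh_le_cosh.2 (by rw [abs_of_pos hc.1, abs_of_pos hs]; exact hc.2.le)
  gcongr

theorem sinh_le_mul_exp (s : ℝ) : Real.sinh s ≤ s * Real.exp s := by
  have h1 := Real.add_one_le_exp (-(2 * s))
  have h2 : Real.exp (-s) = Real.exp s * Real.exp (-(2 * s)) := by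
    rw [← Real.exp_add]; ring_nf
  rw [Real.sinh_eq, h2]
  nlinarith [Real.exp_pos s]

theorem freeHeatKernel_nonneg (r : ℝ) {t : ℝ} (ht : 0 < t) : 0 ≤ freeHeatKernel r t := by
  unfold freeHeatKernel
  positivity

theorem freeHeatKernel_le {r t : ℝ} (hr : 0 < r) (ht : 0 < t) :
    freeHeatKernel r t ≤ 1 / (π * r ^ 2) := by
  have hexp := Real.add_one_le_exp (r ^ 2 / (4 * t))
  have hx : 0 < r ^ 2 / (4 * t) := by positivity
  unfold freeHeatKernel
  rw [neg_div, Real.exp_neg]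
  calc 1 / (4 * π * t) * (Real.exp (r ^ 2 / (4 * t)))⁻¹
      ≤ 1 / (4 * π * t) * (r ^ 2 / (4 * t))⁻¹ := by gcongr; linarith
    _ = 1 / (π * r ^ 2) := by field_simp

theorem measurable_freeHeatKernel (r : ℝ) : Measurable (freeHeatKernel r) := by
  unfold freeHeatKernel
  fun_prop

theorem integrableOn_exp_mul_freeHeatKernel {a r : ℝ} (ha : a < 0) (hr : 0 < r) :
    IntegrableOn (fun t => Real.exp (a * t) * freeHeatKernel r t) (Ioi 0) := by
  refine Integrable.mono' ((integrableOn_exp_mul_Ioi ha 0).mul_const (1 / (π * r ^ 2)))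
    (Measurable.aestronglyMeasurable ?_) ?_
  · exact (by fun_prop : Measurable fun t : ℝ => Real.exp (a * t)).mul
      (measurable_freeHeatKernel r)
  · filter_upwards [ae_restrict_mem measurableSet_Ioi] with t ht
    rw [Real.norm_of_nonneg (mul_nonneg (Real.exp_pos _).le (freeHeatKernel_nonneg r ht))]
    gcongr
    exact freeHeatKernel_le hr ht

theorem landauHeatKernel_le_freeHeatKernel {h t : ℝ} (r : ℝ) (hh : 0 < h) (ht : 0 < t) :
    landauHeatKernel h r t ≤ freeHeatKernel r t := by
  have hs : 0 < h * t := mul_pos hh ht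
  have hsinh : 0 < Real.sinh (h * t) := Real.sinh_pos_iff.2 hs
  have hle : h * t ≤ Real.sinh (h * t) := Real.self_le_sinh_iff.2 hs.le
  unfold landauHeatKernel freeHeatKernel
  gcongr ?_ * Real.exp ?_
  · rw [div_le_div_iff₀ (by positivity) (by positivity)]
    nlinarith [mul_le_mul_of_nonneg_left hle (by positivity : 0 ≤ 4 * π)]
  · have hcoth : 1 / (h * t) ≤ Real.cosh (h * t) / Real.sinh (h * t) := by
      rw [div_le_div_iff₀ hs hsinh]
      linarith [sinh_le_mul_cosh hs]
    have hmul := mul_le_mul_of_nonneg_left hcoth (by positivity : 0 ≤ h * r ^ 2 / 4)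
    have heq : h * r ^ 2 / 4 * (1 / (h * t)) = r ^ 2 / (4 * t) := by field_simp
    rw [neg_div, neg_div]
    linarith

theorem exp_mul_freeHeatKernel_le_landauHeatKernel {h t : ℝ} (r : ℝ) (hh : 0 < h) (ht : 0 < t) :
    Real.exp (-(h * r ^ 2) / 4) * (Real.exp (-(h * t)) * freeHeatKernel r t) ≤
      landauHeatKernel h r t := by
  have hs : 0 < h * t := mul_pos hh ht
  have hsinh : 0 < Real.sinh (h * t) := Real.sinh_pos_iff.2 hs
  have hle : h * t ≤ Real.sinh (h * t) := Real.self_le_sinh_iff.2 hs.le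
  have hprefactor :
      Real.exp (-(h * t)) * (1 / (4 * π * t)) ≤ h / (4 * π * Real.sinh (h * t)) := by
    rw [Real.exp_neg, ← one_div, one_div_mul_one_div, div_le_div_iff₀ (by positivity)
      (by positivity)]
    nlinarith [mul_le_mul_of_nonneg_left (sinh_le_mul_exp (h * t)) (by positivity : 0 ≤ 4 * π)]
  have hcoth : Real.cosh (h * t) / Real.sinh (h * t) ≤ 1 + 1 / (h * t) := by
    have hexp : Real.exp (-(h * t)) ≤ 1 := Real.exp_le_one_iff.2 (by linarith)
    rw [← Real.cosh_sub_sinh] at hexp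
    rw [show 1 + 1 / (h * t) = (h * t + 1) / (h * t) by field_simp,
      div_le_div_iff₀ hsinh hs]
    nlinarith
  have hexponent : -(h * r ^ 2) / 4 + -(r ^ 2) / (4 * t) ≤
      -(h * r ^ 2 * (Real.cosh (h * t) / Real.sinh (h * t))) / 4 := by
    have hmul := mul_le_mul_of_nonneg_left hcoth (by positivity : 0 ≤ h * r ^ 2 / 4)
    have heq : h * r ^ 2 / 4 * (1 + 1 / (h * t)) = h * r ^ 2 / 4 + r ^ 2 / (4 * t) := by
      field_simp
    rw [neg_div, neg_div, neg_div]
    linarith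
  unfold landauHeatKernel freeHeatKernel
  calc _ = Real.exp (-(h * t)) * (1 / (4 * π * t)) *
        Real.exp (-(h * r ^ 2) / 4 + -(r ^ 2) / (4 * t)) := by rw [Real.exp_add]; ring
    _ ≤ _ := by gcongr

/-- For `h>0`, `r>0` and `z∈ℂ` with `Re z<0`:
`|∫₀^∞ e^{zt}(p_h(r,t) − p_0(r,t)) dt| ≤
  ∫₀^∞ e^{(Re z)t} p_0(r,t) dt − exp(−h r²/4) ∫₀^∞ e^{(Re z−h)t} p_0(r,t) dt`.
In Green-function terms:
`|F_h(x,y;z) − G_0(x,y;z)| ≤ G_0(x,y;Re z) − G_0(x,y;Re z−h) exp(−h|x−y|²/4)`. -/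
theorem landau_green_comparison (h r : ℝ) (z : ℂ) (hh : 0 < h) (hr : 0 < r) (hz : z.re < 0) :
    ‖∫ t in Ioi (0 : ℝ),
        Complex.exp (z * t) * ((landauHeatKernel h r t - freeHeatKernel r t : ℝ) : ℂ)‖ ≤
      (∫ t in Ioi (0 : ℝ), Real.exp (z.re * t) * freeHeatKernel r t) -
        Real.exp (-(h * r ^ 2) / 4) *
          ∫ t in Ioi (0 : ℝ), Real.exp ((z.re - h) * t) * freeHeatKernel r t := by
  have hfree := integrableOn_exp_mul_freeHeatKernel hz hr
  have hshift := (integrableOn_exp_mul_freeHeatKernel (by linarith : z.re - h < 0) hr).const_mul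
    (Real.exp (-(h * r ^ 2) / 4))
  rw [← integral_const_mul, ← integral_sub hfree hshift]
  refine norm_integral_le_of_norm_le (hfree.sub hshift) ?_
  filter_upwards [ae_restrict_mem measurableSet_Ioi] with t ht
  have hlower := exp_mul_freeHeatKernel_le_landauHeatKernel r hh ht
  have hnorm : ‖Complex.exp (z * t)‖ = Real.exp (z.re * t) := by
    rw [Complex.norm_exp, Complex.re_mul_ofReal]
  rw [norm_mul, hnorm, Complex.norm_real, Real.norm_eq_abs,
    abs_of_nonpos (sub_nonpos.2 (landauHeatKernel_le_freeHeatKernel r hh ht)),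
    show (z.re - h) * t = z.re * t + -(h * t) by ring, Real.exp_add]
  have := mul_le_mul_of_nonneg_left hlower (Real.exp_pos (z.re * t)).le
  linarith
end

section
/- For every h>0 there exists C>0 such that for every z∈ℂ with Re z ≤ 0 and every r ≥ 1 one has |∫₀^∞ e^{zt} p_h(r,t) dt| ≤ C·exp(−h·r²/4). In particular, the coefficients λ(m,n;z,h) := ∫₀^∞ e^{zt} p_h(√(m²+n²),t) dt satisfy |λ(m,n;z,h)| ≤ C·exp(−h(m²+n²)/4) for all (m,n)∈ℤ² with |m|+|n| ≥ 1 and all z with Re z<0. -/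
open MeasureTheory Real Set

/-- Since `coth s = 1 + exp (-s) / sinh s`, the Gaussian factor `exp (-h r² / 4)` splits off, and
what is left decays exponentially in `t`, uniformly in `r ≥ 1`. -/
theorem landauHeatKernel_le {h r t : ℝ} (hh : 0 < h) (hr : 1 ≤ r ^ 2) (ht : 0 < t) :
    landauHeatKernel h r t ≤
      h / (2 * π * min 1 (h / 2)) * Real.exp (-(h * r ^ 2) / 4) * Real.exp (-h * t) := by
  have hS : 0 < Real.sinh (h * t) := Real.sinh_pos_iff.2 (mul_pos hh ht)
  have hE : 0 < Real.exp (-h * t) := Real.exp_pos _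
  have hcosh : Real.cosh (h * t) = Real.sinh (h * t) + Real.exp (-h * t) := by
    rw [neg_mul, ← Real.cosh_sub_sinh]; ring
  have hmul : Real.exp (-h * t) * (2 * Real.sinh (h * t) + Real.exp (-h * t)) = 1 := by
    have h1 := Real.cosh_sq_sub_sinh_sq (h * t)
    rw [hcosh] at h1
    linarith
  unfold landauHeatKernel
  rw [hcosh]
  generalize Real.sinh (h * t) = S at *
  generalize Real.exp (-h * t) = E at *
  have hc : 0 < min 1 (h / 2) := lt_min one_pos (by positivity)
  have hc1 : min 1 (h / 2) ≤ 1 := min_le_left _ _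
  have hc2 : min 1 (h / 2) ≤ h / 2 := min_le_right _ _
  generalize min 1 (h / 2) = c at *
  have hexp : Real.exp (-(h * r ^ 2 * ((S + E) / S)) / 4) ≤
      Real.exp (-(h * r ^ 2) / 4) * (1 + h * (E / S) / 4)⁻¹ := by
    have hsplit : -(h * r ^ 2 * ((S + E) / S)) / 4 =
        -(h * r ^ 2) / 4 + -(h * r ^ 2 * (E / S) / 4) := by
      field_simp; ring
    rw [hsplit, Real.exp_add]
    gcongr
    rw [Real.exp_neg]
    gcongr
    calc 1 + h * (E / S) / 4 ≤ Real.exp (h * (E / S) / 4) := by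
          rw [add_comm]; exact Real.add_one_le_exp _
      _ ≤ Real.exp (h * r ^ 2 * (E / S) / 4) := by
          gcongr
          exact le_mul_of_one_le_right hh.le hr
  have hkey : S⁻¹ * (1 + h * (E / S) / 4)⁻¹ ≤ 2 * E / c := by
    have hden : S * (1 + h * (E / S) / 4) = S + h * E / 4 := by field_simp
    rw [← mul_inv, hden, inv_eq_one_div, div_le_div_iff₀ (by positivity) hc]
    nlinarith [mul_nonneg (sub_nonneg.2 hc1) (mul_pos hE hS).le,
      mul_nonneg (sub_nonneg.2 hc2) (mul_pos hE hE).le]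
  calc h / (4 * π * S) * Real.exp (-(h * r ^ 2 * ((S + E) / S)) / 4)
      ≤ h / (4 * π * S) * (Real.exp (-(h * r ^ 2) / 4) * (1 + h * (E / S) / 4)⁻¹) := by gcongr
    _ = h / (4 * π) * Real.exp (-(h * r ^ 2) / 4) * (S⁻¹ * (1 + h * (E / S) / 4)⁻¹) := by
        rw [← div_div, div_eq_mul_inv _ S]; ring
    _ ≤ h / (4 * π) * Real.exp (-(h * r ^ 2) / 4) * (2 * E / c) := by gcongr
    _ = h / (2 * π * c) * Real.exp (-(h * r ^ 2) / 4) * E := by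
        field_simp; ring

theorem landauHeatKernel_nonneg {h r t : ℝ} (hh : 0 ≤ h) (ht : 0 ≤ t) :
    0 ≤ landauHeatKernel h r t := by
  have : 0 ≤ Real.sinh (h * t) := Real.sinh_nonneg_iff.2 (mul_nonneg hh ht)
  unfold landauHeatKernel
  positivity

theorem norm_integral_exp_mul_landauHeatKernel_le {h r : ℝ} {z : ℂ} (hh : 0 < h)
    (hz : z.re ≤ 0) (hr : 1 ≤ r ^ 2) :
    ‖∫ t in Ioi (0 : ℝ), Complex.exp (z * t) * ((landauHeatKernel h r t : ℝ) : ℂ)‖ ≤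
      1 / (2 * π * min 1 (h / 2)) * Real.exp (-(h * r ^ 2) / 4) := by
  have hint : IntegrableOn (fun t : ℝ ↦ Real.exp (-h * t)) (Ioi 0) :=
    integrableOn_exp_mul_Ioi (neg_lt_zero.2 hh) 0
  refine (norm_integral_le_of_norm_le (hint.const_mul
    (h / (2 * π * min 1 (h / 2)) * Real.exp (-(h * r ^ 2) / 4))) ?_).trans_eq ?_
  · filter_upwards [ae_restrict_mem measurableSet_Ioi] with t ht
    have hexp : Real.exp (z * t).re ≤ 1 := by
      rw [Complex.re_mul_ofReal]
      exact Real.exp_le_one_iff.2 (mul_nonpos_of_nonpos_of_nonneg hz (le_of_lt ht))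
    have hnonneg := landauHeatKernel_nonneg (r := r) hh.le (le_of_lt ht)
    rw [norm_mul, Complex.norm_exp, Complex.norm_of_nonneg hnonneg]
    exact (mul_le_of_le_one_left hnonneg hexp).trans (landauHeatKernel_le hh hr ht)
  · rw [integral_const_mul, integral_exp_mul_Ioi (neg_lt_zero.2 hh)]
    simp only [mul_zero, Real.exp_zero]
    field_simp

/-- For every `h>0` there is `C>0` such that for `Re z ≤ 0` and `r ≥ 1`,
`|∫₀^∞ e^{zt} p_h(r,t) dt| ≤ C exp(−h r²/4)`; in particular the lattice Green-function
coefficients `λ(m,n;z,h) = ∫₀^∞ e^{zt} p_h(√(m²+n²),t) dt` satisfy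
`|λ(m,n;z,h)| ≤ C exp(−h(m²+n²)/4)` for `|m|+|n| ≥ 1` and `Re z<0`. -/
theorem landau_green_gaussian_decay (h : ℝ) (hh : 0 < h) :
    ∃ C > 0,
      (∀ (z : ℂ) (r : ℝ), z.re ≤ 0 → 1 ≤ r →
        ‖∫ t in Ioi (0 : ℝ), Complex.exp (z * t) * ((landauHeatKernel h r t : ℝ) : ℂ)‖ ≤
          C * Real.exp (-(h * r ^ 2) / 4)) ∧
      (∀ (z : ℂ) (m n : ℤ), z.re < 0 → 1 ≤ |m| + |n| →
        ‖∫ t in Ioi (0 : ℝ), Complex.exp (z * t) *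
            ((landauHeatKernel h (Real.sqrt ((m : ℝ) ^ 2 + (n : ℝ) ^ 2)) t : ℝ) : ℂ)‖ ≤
          C * Real.exp (-(h * ((m : ℝ) ^ 2 + (n : ℝ) ^ 2)) / 4)) := by
  have hc : 0 < min 1 (h / 2) := lt_min one_pos (by positivity)
  refine ⟨1 / (2 * π * min 1 (h / 2)), by positivity, fun z r hz hr ↦ ?_, fun z m n hz hmn ↦ ?_⟩
  · exact norm_integral_exp_mul_landauHeatKernel_le hh hz (one_le_pow₀ hr)
  · have hsq : Real.sqrt ((m : ℝ) ^ 2 + (n : ℝ) ^ 2) ^ 2 = (m : ℝ) ^ 2 + (n : ℝ) ^ 2 :=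
      Real.sq_sqrt (by positivity)
    have hone : 1 ≤ m ^ 2 + n ^ 2 := by
      by_contra! hlt
      have hm : m = 0 := by nlinarith [sq_nonneg m, sq_nonneg n]
      have hn : n = 0 := by nlinarith [sq_nonneg m, sq_nonneg n]
      simp [hm, hn] at hmn
    have hbound := norm_integral_exp_mul_landauHeatKernel_le
      (r := Real.sqrt ((m : ℝ) ^ 2 + (n : ℝ) ^ 2)) hh hz.le (by rw [hsq]; exact_mod_cast hone)
    rwa [hsq] at hbound
end
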